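/- Superquadratic remainder bound: for d ∈ {3,4,5,6}, define C(v) = ∫ [ (|v+W|^{2*} − W^{2*})/2* − W^{2*−1}v − ((2*−1)/2) W^{2*−2} v² ] dx. Then there is C₀ such that for all v ∈ Ḣ¹(ℝ^d) with ‖∇v‖₂ ≤ 1, |C(v)| ≤ C₀ ‖∇v‖₂³ (for d ≤ 6, where 2* ≥ 3). -/

import Mathlib

open MeasureTheory Real
noncomputable section
abbrev Rd (d : ℕ) := EuclideanSpace ℝ (Fin d)
/-- critical Sobolev exponent 2* = 2d/(d-2) -/
def pstar (d : ℕ) : ℝ := 2*d/((d:ℝ)-2)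
/-- Aubin–Talenti ground state -/
def W (d : ℕ) (x : Rd d) : ℝ := (1 + ‖x‖^2 / ((d:ℝ)*((d:ℝ)-2))) ^ (((2:ℝ)-d)/2)
/-- squared homogeneous H^1 norm -/
def gradSq (d : ℕ) (φ : Rd d → ℝ) : ℝ := ∫ x, ‖gradient φ x‖^2
/-- L^{2*} norm to the power 2* -/
def lpP (d : ℕ) (φ : Rd d → ℝ) : ℝ := ∫ x, |φ x| ^ pstar d
/-- virial functional K -/
def Kf (d : ℕ) (φ : Rd d → ℝ) : ℝ := gradSq d φ - lpP d φ
/-- static energy J -/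
def Jf (d : ℕ) (φ : Rd d → ℝ) : ℝ := (1/2) * gradSq d φ - (1/(pstar d)) * lpP d φ
/-- Laplacian as sum of second partial derivatives -/
def lap (d : ℕ) (f : Rd d → ℝ) (x : Rd d) : ℝ :=
  ∑ i : Fin d, fderiv ℝ (fun y => fderiv ℝ f y (EuclideanSpace.single i 1)) x (EuclideanSpace.single i 1)
/-- H^1-invariant dilation T_λ φ(x) = λ^{d/2-1} φ(λ x) -/
def Tdil (d : ℕ) (lam : ℝ) (φ : Rd d → ℝ) (x : Rd d) : ℝ := lam ^ ((d:ℝ)/2 - 1) * φ (lam • x)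

/-- superquadratic part of the energy -/
def Cfun (d : ℕ) (v : Rd d → ℝ) : ℝ :=
  ∫ x, ((|v x + W d x| ^ pstar d - (W d x) ^ pstar d) / pstar d
        - (W d x) ^ (pstar d - 1) * v x
        - (pstar d - 1)/2 * (W d x) ^ (pstar d - 2) * (v x)^2)

open Function in
theorem ae_lintegral_update_lt_top {n : ℕ} (i : Fin (n + 1)) {f : (Fin (n + 1) → ℝ) → ENNReal}
    (hf : Measurable f) (hfi : ∫⁻ x, f x ≠ ⊤) :
    ∀ᵐ x : Fin (n + 1) → ℝ, ∫⁻ t, f (update x i t) < ⊤ := by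
  have hmp := volume_preserving_piFinSuccAbove (fun _ : Fin (n + 1) => ℝ) i
  set e := MeasurableEquiv.piFinSuccAbove (fun _ : Fin (n + 1) => ℝ) i
  have hfe : Measurable fun z => f (e.symm z) := hf.comp e.symm.measurable
  have hint : ∫⁻ y, ∫⁻ t, f (e.symm (t, y)) ≠ ⊤ := by
    rw [← lintegral_prod_symm (fun z => f (e.symm z)) hfe.aemeasurable]
    rw [← Measure.volume_eq_prod, ← hmp.lintegral_comp hfe]
    simpa using hfi
  have hae := ae_lt_top (Measurable.lintegral_prod_left' hfe) hint
  have hae' := (Measure.quasiMeasurePreserving_snd (μ := (volume : Measure ℝ))).ae hae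
  rw [← Measure.volume_eq_prod] at hae'
  filter_upwards [hmp.quasiMeasurePreserving.ae hae'] with x hx
  have hupd (t : ℝ) : e.symm (t, (e x).2) = update x i t := by
    rw [← Fin.insertNth_removeNth]
    rfl
  simpa only [hupd] using hx

theorem enorm_le_lintegral_deriv_of_lintegral_rpow_lt_top {g g' : ℝ → ℝ}
    (hg : ∀ t, HasDerivAt g (g' t) t) {q : ℝ} (hq : 0 ≤ q)
    (hfin : ∫⁻ t, ‖g t‖ₑ ^ q < ⊤) (x : ℝ) : ‖g x‖ₑ ≤ ∫⁻ t, ‖g' t‖ₑ := by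
  by_contra! hlt
  have hmeas : Measurable g' := by
    rw [show g' = deriv g from funext fun t => (hg t).deriv.symm]
    exact measurable_deriv g
  have hint : Integrable g' := ⟨hmeas.aestronglyMeasurable, hlt.trans enorm_lt_top⟩
  have hbound (y : ℝ) : ‖g x‖ₑ - ∫⁻ t, ‖g' t‖ₑ ≤ ‖g y‖ₑ := by
    rw [tsub_le_iff_right]
    have hftc : ∫ t in y..x, g' t = g x - g y :=
      intervalIntegral.integral_eq_sub_of_hasDerivAt (fun t _ => hg t) hint.intervalIntegrable
    calc ‖g x‖ₑ = ‖g y + (∫ t in y..x, g' t)‖ₑ := by rw [hftc]; congr 1; ring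
      _ ≤ ‖g y‖ₑ + ‖∫ t in y..x, g' t‖ₑ := enorm_add_le _ _
      _ ≤ ‖g y‖ₑ + ∫⁻ t, ‖g' t‖ₑ := by
        gcongr
        rw [← enorm_norm, intervalIntegral.norm_intervalIntegral_eq, enorm_norm]
        exact (enorm_integral_le_lintegral_enorm _).trans (setLIntegral_le_lintegral _ _)
  have hpos : 0 < ‖g x‖ₑ - ∫⁻ t, ‖g' t‖ₑ := tsub_pos_of_lt hlt
  have htop : ∫⁻ _ : ℝ, (‖g x‖ₑ - ∫⁻ t, ‖g' t‖ₑ) ^ q = ⊤ := by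
    rw [lintegral_const, Real.volume_univ]
    exact ENNReal.mul_top (ENNReal.rpow_pos hpos (by simp)).ne'
  refine absurd hfin (not_lt.2 ?_)
  rw [← htop]
  gcongr with y
  exact hbound y

open Function in
theorem lintegral_rpow_le_of_hasDerivAt_update {n : ℕ} {p : ℝ}
    (hp : Real.HolderConjugate ((n + 1 : ℕ) : ℝ) p) {u : (Fin (n + 1) → ℝ) → ℝ}
    (hu : Measurable u) {D : Fin (n + 1) → (Fin (n + 1) → ℝ) → ℝ}
    (hD : ∀ i x, HasDerivAt (fun t => u (update x i t)) (D i x) (x i))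
    {f : (Fin (n + 1) → ℝ) → ENNReal} (hf : Measurable f) (hDf : ∀ i x, ‖D i x‖ₑ ≤ f x)
    (hfin : ∫⁻ x, ‖u x‖ₑ ^ p ≠ ⊤) :
    ∫⁻ x, ‖u x‖ₑ ^ p ≤ (∫⁻ x, f x) ^ p := by
  have hn : (0 : ℝ) < n := by have := hp.lt; push_cast at this; linarith
  have hpn : p = 1 / (n : ℝ) * (n + 1 : ℕ) := by
    rw [hp.conjugate_eq]
    push_cast
    rw [add_sub_cancel_right]
    field_simp
  have hcard : (Fintype.card (Fin (n + 1)) : ℝ) - 1 = n := by simp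
  have hline : ∀ᵐ x : Fin (n + 1) → ℝ, ∀ i, ∫⁻ t, ‖u (update x i t)‖ₑ ^ p < ⊤ :=
    ae_all_iff.2 fun i => ae_lintegral_update_lt_top i (hu.enorm.pow_const p) hfin
  calc ∫⁻ x, ‖u x‖ₑ ^ p
      = ∫⁻ x, ∏ _i : Fin (n + 1), ‖u x‖ₑ ^ (1 / (n : ℝ)) := by
        congr! 2 with x
        rw [Finset.prod_const, Finset.card_univ, Fintype.card_fin, hpn, ENNReal.rpow_mul,
          ENNReal.rpow_natCast]
    _ ≤ ∫⁻ x, ∏ i, (∫⁻ t, f (update x i t)) ^ (1 / (n : ℝ)) := by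
        refine lintegral_mono_ae ?_
        filter_upwards [hline] with x hx
        refine Finset.prod_le_prod' fun i _ => ?_
        gcongr
        calc ‖u x‖ₑ = ‖u (update x i (x i))‖ₑ := by simp
          _ ≤ ∫⁻ t, ‖D i (update x i t)‖ₑ := by
            refine enorm_le_lintegral_deriv_of_lintegral_rpow_lt_top
              (g := fun t => u (update x i t)) (fun t => ?_) hp.symm.nonneg (hx i) (x i)
            simpa using hD i (update x i t)
          _ ≤ ∫⁻ t, f (update x i t) := lintegral_mono fun t => hDf i _
    _ ≤ (∫⁻ x, f x) ^ p := by
        have := lintegral_prod_lintegral_pow_le (fun _ : Fin (n + 1) => (volume : Measure ℝ))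
          (p := p) (by simpa using hp) hf
        rw [hcard] at this
        exact this

theorem abs_le_of_hasDerivAt_of_abs_le {g g' : ℝ → ℝ} {r M : ℝ} (hM : 0 ≤ M) (hg0 : g 0 = 0)
    (hg : ∀ t, |t| ≤ r → HasDerivAt g (g' t) t) (hg' : ∀ t, |t| ≤ r → |g' t| ≤ M)
    {t : ℝ} (ht : |t| ≤ r) : |g t| ≤ M * r := by
  have hr : 0 ≤ r := (abs_nonneg t).trans ht
  have hball : ∀ s ∈ Metric.closedBall (0 : ℝ) r, |s| ≤ r := fun s hs => by simpa using hs
  have := (convex_closedBall (0 : ℝ) r).norm_image_sub_le_of_norm_hasDerivWithin_le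
    (fun s hs => (hg s (hball s hs)).hasDerivWithinAt) (fun s hs => hg' s (hball s hs))
    (by simpa using hr : (0 : ℝ) ∈ Metric.closedBall (0 : ℝ) r)
    (by simpa using ht : t ∈ Metric.closedBall (0 : ℝ) r)
  rw [hg0, sub_zero, sub_zero] at this
  exact this.trans (mul_le_mul_of_nonneg_left ht hM)

theorem abs_taylor_rpow_le_of_abs_le_half {p a b : ℝ} (hp : 3 ≤ p) (ha : 0 < a)
    (hb : |b| ≤ a / 2) :
    |(|b + a| ^ p - a ^ p) / p - a ^ (p - 1) * b - (p - 1) / 2 * a ^ (p - 2) * b ^ 2| ≤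
      (p - 1) * (p - 2) * 2 ^ (p - 3) * (|b| ^ 3 * a ^ (p - 3)) := by
  have hpos (t : ℝ) (ht : |t| ≤ |b|) : 0 < t + a := by
    have := (abs_le.1 (ht.trans hb)).1
    linarith
  have hle (t : ℝ) (ht : |t| ≤ |b|) : t + a ≤ 2 * a := by
    have := (abs_le.1 (ht.trans hb)).2
    linarith
  have hpow (r : ℝ) (t : ℝ) (ht : |t| ≤ |b|) :
      HasDerivAt (fun t => (t + a) ^ r) (r * (t + a) ^ (r - 1)) t := by
    simpa using ((hasDerivAt_id t).add_const a).rpow_const (p := r) (Or.inl (hpos t ht).ne')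
  set M := (p - 1) * (p - 2) * 2 ^ (p - 3) * a ^ (p - 3) with hM
  have hM0 : 0 ≤ M := by
    have h1 : 0 ≤ p - 1 := by linarith
    have h2 : 0 ≤ p - 2 := by linarith
    positivity
  have h3 (t : ℝ) (ht : |t| ≤ |b|) : |(p - 1) * (p - 2) * (t + a) ^ (p - 3)| ≤ M := by
    have h1 : 0 ≤ p - 1 := by linarith
    have h2 : 0 ≤ p - 2 := by linarith
    rw [abs_of_nonneg (mul_nonneg (mul_nonneg h1 h2) (rpow_nonneg (hpos t ht).le _)), hM,
      mul_assoc _ (2 ^ (p - 3)), ← mul_rpow zero_le_two ha.le]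
    have := rpow_le_rpow (hpos t ht).le (hle t ht) (by linarith : 0 ≤ p - 3)
    gcongr
  have h2 (t : ℝ) (ht : |t| ≤ |b|) :
      |(p - 1) * (t + a) ^ (p - 2) - (p - 1) * a ^ (p - 2)| ≤ M * |b| := by
    refine abs_le_of_hasDerivAt_of_abs_le
      (g := fun t => (p - 1) * (t + a) ^ (p - 2) - (p - 1) * a ^ (p - 2)) hM0 (by simp)
      (fun s hs => ?_) h3 ht
    refine (((hpow (p - 2) s hs).const_mul (p - 1)).sub_const _).congr_deriv ?_
    rw [show p - 2 - 1 = p - 3 by ring]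
    ring
  have h1 (t : ℝ) (ht : |t| ≤ |b|) :
      |(t + a) ^ (p - 1) - a ^ (p - 1) - (p - 1) * a ^ (p - 2) * t| ≤ M * |b| * |b| := by
    refine abs_le_of_hasDerivAt_of_abs_le
      (g := fun t => (t + a) ^ (p - 1) - a ^ (p - 1) - (p - 1) * a ^ (p - 2) * t)
      (by positivity) (by simp) (fun s hs => ?_) h2 ht
    refine (((hpow (p - 1) s hs).sub_const _).sub
      ((hasDerivAt_id s).const_mul ((p - 1) * a ^ (p - 2)))).congr_deriv ?_
    rw [show p - 1 - 1 = p - 2 by ring]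
    ring
  have h0 : |((b + a) ^ p - a ^ p) / p - a ^ (p - 1) * b - (p - 1) / 2 * a ^ (p - 2) * b ^ 2| ≤
      M * |b| * |b| * |b| := by
    refine abs_le_of_hasDerivAt_of_abs_le
      (g := fun t => ((t + a) ^ p - a ^ p) / p - a ^ (p - 1) * t -
        (p - 1) / 2 * a ^ (p - 2) * t ^ 2)
      (by positivity) (by simp) (fun s hs => ?_) h1 le_rfl
    refine (((((hpow p s hs).sub_const (a ^ p)).div_const p).sub
      ((hasDerivAt_id s).const_mul (a ^ (p - 1)))).sub
      ((hasDerivAt_pow 2 s).const_mul ((p - 1) / 2 * a ^ (p - 2)))).congr_deriv ?_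
    have : p ≠ 0 := by linarith
    push_cast
    field_simp
  rw [abs_of_pos (hpos b le_rfl)]
  refine h0.trans_eq ?_
  rw [hM]
  ring

theorem abs_taylor_rpow_le_of_half_le_abs {p a b : ℝ} (hp : 3 ≤ p) (ha : 0 < a)
    (hb : a / 2 ≤ |b|) :
    |(|b + a| ^ p - a ^ p) / p - a ^ (p - 1) * b - (p - 1) / 2 * a ^ (p - 2) * b ^ 2| ≤
      (p + 2) * 3 ^ p * |b| ^ p := by
  have hb0 : 0 < |b| := by linarith
  set B := 3 * |b| with hB
  have hB0 : 0 < B := by positivity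
  have haB : a ≤ B := by linarith
  have hbB : |b| ≤ B := by linarith
  have e1 : |b + a| ^ p ≤ B ^ p := by
    refine rpow_le_rpow (abs_nonneg _) ?_ (by linarith)
    have := abs_add_le b a
    rw [abs_of_pos ha] at this
    linarith
  have e2 : a ^ p ≤ B ^ p := rpow_le_rpow ha.le haB (by linarith)
  have e3 : a ^ (p - 1) * |b| ≤ B ^ p := by
    calc a ^ (p - 1) * |b| ≤ B ^ (p - 1) * B := by
          gcongr
          linarith
      _ = B ^ p := by rw [← rpow_add_one hB0.ne']; congr 1; ring
  have e4 : a ^ (p - 2) * |b| ^ 2 ≤ B ^ p := by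
    calc a ^ (p - 2) * |b| ^ 2 ≤ B ^ (p - 2) * B ^ 2 := by
          gcongr
          linarith
      _ = B ^ p := by rw [← rpow_natCast, ← rpow_add hB0]; congr 1; push_cast; ring
  have hBp : 0 ≤ B ^ p := by positivity
  have f1 : |(|b + a| ^ p - a ^ p) / p| ≤ B ^ p := by
    rw [abs_div, abs_of_pos (by linarith : 0 < p), div_le_iff₀ (by linarith)]
    have : |(|b + a| ^ p - a ^ p)| ≤ B ^ p :=
      abs_sub_le_of_nonneg_of_le (by positivity) e1 (by positivity) e2
    nlinarith
  have f3 : |a ^ (p - 1) * b| ≤ B ^ p := by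
    rwa [abs_mul, abs_of_nonneg (by positivity)]
  have f4 : |(p - 1) / 2 * a ^ (p - 2) * b ^ 2| ≤ p * B ^ p := by
    rw [← sq_abs b, mul_assoc, abs_of_nonneg
      (mul_nonneg (by linarith) (by positivity))]
    nlinarith
  calc _ ≤ |(|b + a| ^ p - a ^ p) / p| + |a ^ (p - 1) * b| +
        |(p - 1) / 2 * a ^ (p - 2) * b ^ 2| :=
        (abs_sub _ _).trans (add_le_add_left (abs_sub _ _) _)
    _ ≤ (p + 2) * B ^ p := by linarith
    _ = (p + 2) * 3 ^ p * |b| ^ p := by rw [hB, mul_rpow (by norm_num) (abs_nonneg b)]; ring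

theorem exists_abs_taylor_rpow_le {p : ℝ} (hp : 3 ≤ p) :
    ∃ K : ℝ, 0 ≤ K ∧ ∀ a b s : ℝ, 0 < a → 0 < s → s ≤ 1 →
      |(|b + a| ^ p - a ^ p) / p - a ^ (p - 1) * b - (p - 1) / 2 * a ^ (p - 2) * b ^ 2| ≤
        K * s ^ 3 * (s ^ (-p) * |b| ^ p + a ^ p) := by
  have h1 : 0 ≤ p - 1 := by linarith
  have h2 : 0 ≤ p - 2 := by linarith
  have h3 : 0 ≤ p - 3 := by linarith
  refine ⟨max ((p - 1) * (p - 2) * 2 ^ (p - 3)) ((p + 2) * 3 ^ p), le_max_of_le_left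
    (by positivity), fun a b s ha hs hs1 => ?_⟩
  set K := max ((p - 1) * (p - 2) * 2 ^ (p - 3)) ((p + 2) * 3 ^ p) with hK
  have hK0 : 0 ≤ K := le_max_of_le_left (by positivity)
  have hs3 : s ^ 3 * s ^ (-p) * s ^ (p - 3) = 1 := by
    rw [← rpow_natCast, ← rpow_add hs, ← rpow_add hs]
    rw [show ((3 : ℕ) : ℝ) + -p + (p - 3) = 0 by push_cast; ring, rpow_zero]
  rcases le_total |b| (a / 2) with hb | hb
  · refine (abs_taylor_rpow_le_of_abs_le_half hp ha hb).trans ?_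
    rw [mul_assoc K]
    refine mul_le_mul (le_max_left _ _) ?_ (by positivity) hK0
    set c := |b| / s with hc
    have hc0 : 0 ≤ c := by positivity
    have hbc : |b| = s * c := by rw [hc]; field_simp
    have hcp : s ^ (-p) * |b| ^ p = c ^ p := by
      rw [hc, div_rpow (abs_nonneg b) hs.le, rpow_neg hs.le]; ring
    rw [hcp, hbc, mul_pow, mul_assoc]
    gcongr
    have hsplit (x : ℝ) (hx : 0 < x) : x ^ 3 * x ^ (p - 3) = x ^ p := by
      rw [← rpow_natCast, ← rpow_add hx]; congr 1; push_cast; ring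
    rcases le_total c a with hca | hca
    · calc c ^ 3 * a ^ (p - 3) ≤ a ^ 3 * a ^ (p - 3) := by gcongr
        _ = a ^ p := hsplit a ha
        _ ≤ c ^ p + a ^ p := by linarith [rpow_nonneg hc0 p]
    · calc c ^ 3 * a ^ (p - 3) ≤ c ^ 3 * c ^ (p - 3) := by gcongr
        _ = c ^ p := hsplit c (ha.trans_le hca)
        _ ≤ c ^ p + a ^ p := by linarith [rpow_nonneg ha.le p]
  · refine (abs_taylor_rpow_le_of_half_le_abs hp ha hb).trans ?_
    rw [mul_assoc K]
    refine mul_le_mul (le_max_right _ _) ?_ (by positivity) hK0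
    have hone : 1 ≤ s ^ 3 * s ^ (-p) := by
      rw [← hs3]
      exact mul_le_of_le_one_right (by positivity) (rpow_le_one hs.le hs1 h3)
    calc |b| ^ p ≤ s ^ 3 * s ^ (-p) * |b| ^ p := le_mul_of_one_le_left (by positivity) hone
      _ ≤ s ^ 3 * (s ^ (-p) * |b| ^ p + a ^ p) := by
        rw [mul_add, ← mul_assoc]
        linarith [mul_nonneg (pow_nonneg hs.le 3) (rpow_nonneg ha.le p)]

theorem hasDerivAt_toLp_update {ι : Type*} [Fintype ι] [DecidableEq ι] (i : ι) (y : ι → ℝ)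
    (t : ℝ) :
    HasDerivAt (fun t => WithLp.toLp 2 (Function.update y i t)) (EuclideanSpace.single i 1) t :=
  ((PiLp.continuousLinearEquiv 2 ℝ (fun _ : ι => ℝ)).symm.hasFDerivAt).comp_hasDerivAt t
    (hasDerivAt_update y i t)

theorem norm_gradient_eq_norm_fderiv {E : Type*} [NormedAddCommGroup E] [InnerProductSpace ℝ E]
    [CompleteSpace E] (v : E → ℝ) (x : E) : ‖gradient v x‖ = ‖fderiv ℝ v x‖ := by
  simp [gradient]

theorem measurable_norm_gradient {E : Type*} [NormedAddCommGroup E] [InnerProductSpace ℝ E]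
    [CompleteSpace E] [MeasurableSpace E] [OpensMeasurableSpace E] (v : E → ℝ) :
    Measurable fun x => ‖gradient v x‖ := by
  simp only [norm_gradient_eq_norm_fderiv]
  exact (measurable_fderiv ℝ v).norm

theorem le_rpow_mul_of_le_rpow {A G c p q : ℝ} (hA : 0 ≤ A) (hG : 0 ≤ G) (hc : 0 ≤ c)
    (hp : 0 < p) (hq : 0 < q) (hpq : 1 / q = 1 / p + 1 / 2)
    (h : A ≤ (c * (A ^ (1 / 2 : ℝ) * G ^ (1 / 2 : ℝ))) ^ q) :
    A ≤ c ^ p * G ^ (p / 2) := by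
  rcases hA.eq_or_lt with rfl | hA
  · positivity
  have h1 : A ^ (1 / q) ≤ c * (A ^ (1 / 2 : ℝ) * G ^ (1 / 2 : ℝ)) := by
    rw [one_div, rpow_inv_le_iff_of_pos hA.le (by positivity) hq]
    exact h
  rw [hpq, rpow_add hA] at h1
  have h2 : A ^ (1 / p) ≤ c * G ^ (1 / 2 : ℝ) := by
    refine le_of_mul_le_mul_right (h1.trans_eq ?_) (rpow_pos_of_pos hA (1 / 2))
    ring
  rw [one_div, rpow_inv_le_iff_of_pos hA.le (by positivity) hp,
    mul_rpow hc (by positivity), ← rpow_mul hG] at h2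
  rwa [show 1 / 2 * p = p / 2 by ring] at h2

theorem integral_abs_rpow_le_mul_gradient_rpow {n : ℕ} {p q c : ℝ}
    (hq : Real.HolderConjugate ((n + 1 : ℕ) : ℝ) q) (hc : 1 < c) (hcq : c * q = p)
    (hcp : (c - 1) * 2 = p) {v : Rd (n + 1) → ℝ} (hv : Differentiable ℝ v)
    (hgrad : Integrable fun x => ‖gradient v x‖ ^ 2) (hvp : Integrable fun x => |v x| ^ p) :
    ∫ x, |v x| ^ p ≤ (c * ((∫ x, |v x| ^ p) ^ (1 / 2 : ℝ) *
      (∫ x, ‖gradient v x‖ ^ 2) ^ (1 / 2 : ℝ))) ^ q := by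
  have hmp := PiLp.volume_preserving_toLp (Fin (n + 1))
  have hvm : Measurable v := hv.continuous.measurable
  have hgm := measurable_norm_gradient v
  have hq0 : 0 ≤ q := hq.symm.nonneg
  have hsq (x : Rd (n + 1)) : (|v x| ^ (c - 1)) ^ 2 = |v x| ^ p := by
    rw [← rpow_natCast, ← rpow_mul (abs_nonneg _), ← hcp]
    norm_cast
  have hL1 : MemLp (fun x => |v x| ^ (c - 1)) 2 :=
    (memLp_two_iff_integrable_sq (hvm.abs.pow_const _).aestronglyMeasurable).2 (by simpa only [hsq] using hvp)
  have hL2 : MemLp (fun x => ‖gradient v x‖) 2 :=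
    (memLp_two_iff_integrable_sq hgm.aestronglyMeasurable).2 hgrad
  have hFint : Integrable fun x => c * (|v x| ^ (c - 1) * ‖gradient v x‖) :=
    (hL1.integrable_mul hL2).const_mul c
  have hholder : ∫ x, c * (|v x| ^ (c - 1) * ‖gradient v x‖) ≤
      c * ((∫ x, |v x| ^ p) ^ (1 / 2 : ℝ) * (∫ x, ‖gradient v x‖ ^ 2) ^ (1 / 2 : ℝ)) := by
    rw [integral_const_mul]
    refine mul_le_mul_of_nonneg_left ?_ (by linarith)
    have := integral_mul_le_Lp_mul_Lq_of_nonneg (μ := (volume : Measure (Rd (n + 1))))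
      Real.HolderConjugate.two_two
      (Filter.Eventually.of_forall fun x => rpow_nonneg (abs_nonneg (v x)) (c - 1))
      (Filter.Eventually.of_forall fun x => norm_nonneg (gradient v x))
      (by simpa using hL1) (by simpa using hL2)
    simpa only [rpow_two, hsq] using this
  have hlhs (y : Fin (n + 1) → ℝ) : ‖|v (WithLp.toLp 2 y)| ^ c‖ₑ ^ q =
      ENNReal.ofReal (|v (WithLp.toLp 2 y)| ^ p) := by
    rw [Real.enorm_of_nonneg (by positivity), ENNReal.ofReal_rpow_of_nonneg (by positivity) hq0,
      ← rpow_mul (abs_nonneg _), hcq]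
  have hlhs' : ∫⁻ y : Fin (n + 1) → ℝ, ‖|v (WithLp.toLp 2 y)| ^ c‖ₑ ^ q =
      ENNReal.ofReal (∫ x, |v x| ^ p) := by
    simp only [hlhs]
    rw [ofReal_integral_eq_lintegral_ofReal hvp
      (Filter.Eventually.of_forall fun x => by positivity)]
    exact hmp.lintegral_comp (f := fun x => ENNReal.ofReal (|v x| ^ p)) (by fun_prop)
  have hrhs : ∫⁻ y : Fin (n + 1) → ℝ, ENNReal.ofReal
      (c * (|v (WithLp.toLp 2 y)| ^ (c - 1) * ‖gradient v (WithLp.toLp 2 y)‖)) =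
      ENNReal.ofReal (∫ x, c * (|v x| ^ (c - 1) * ‖gradient v x‖)) := by
    rw [ofReal_integral_eq_lintegral_ofReal hFint
      (Filter.Eventually.of_forall fun x => by positivity)]
    exact hmp.lintegral_comp
      (f := fun x => ENNReal.ofReal (c * (|v x| ^ (c - 1) * ‖gradient v x‖))) (by fun_prop)
  have hsob := lintegral_rpow_le_of_hasDerivAt_update hq
    (u := fun y => |v (WithLp.toLp 2 y)| ^ c)
    (D := fun i y => c * |v (WithLp.toLp 2 y)| ^ (c - 2) * v (WithLp.toLp 2 y) *
      fderiv ℝ v (WithLp.toLp 2 y) (EuclideanSpace.single i 1))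
    (f := fun y => ENNReal.ofReal
      (c * (|v (WithLp.toLp 2 y)| ^ (c - 1) * ‖gradient v (WithLp.toLp 2 y)‖)))
    ((hvm.comp hmp.measurable).abs.pow_const c) (fun i y => ?_)
    (Measurable.ennreal_ofReal (by
      have := hvm.comp hmp.measurable
      have := hgm.comp hmp.measurable
      fun_prop)) (fun i y => ?_)
    (by rw [hlhs']; exact ENNReal.ofReal_ne_top)
  · rw [hlhs', hrhs, ENNReal.ofReal_rpow_of_nonneg
      (integral_nonneg fun x => by positivity) hq0,
      ENNReal.ofReal_le_ofReal_iff
        (rpow_nonneg (integral_nonneg fun x => by positivity) _)] at hsob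
    exact hsob.trans (rpow_le_rpow (integral_nonneg fun x => by positivity) hholder hq0)
  · have h1 : HasDerivAt (fun t => v (WithLp.toLp 2 (Function.update y i t)))
        (fderiv ℝ v (WithLp.toLp 2 y) (EuclideanSpace.single i 1)) (y i) := by
      refine HasFDerivAt.comp_hasDerivAt (y i) ?_ (hasDerivAt_toLp_update i y (y i))
      simpa using (hv (WithLp.toLp 2 y)).hasFDerivAt
    have h2 := hasDerivAt_abs_rpow (v (WithLp.toLp 2 (Function.update y i (y i)))) hc
    simpa [Function.comp_def] using h2.comp (y i) h1
  · rw [Real.enorm_eq_ofReal_abs]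
    refine ENNReal.ofReal_le_ofReal ?_
    have hpow : |v (WithLp.toLp 2 y)| ^ (c - 1) =
        |v (WithLp.toLp 2 y)| ^ (c - 2) * |v (WithLp.toLp 2 y)| := by
      rw [← rpow_add_one' (abs_nonneg _) (by linarith)]
      congr 1
      ring
    have hfd : |fderiv ℝ v (WithLp.toLp 2 y) (EuclideanSpace.single i 1)| ≤
        ‖gradient v (WithLp.toLp 2 y)‖ := by
      rw [norm_gradient_eq_norm_fderiv]
      simpa using (fderiv ℝ v (WithLp.toLp 2 y)).le_opNorm (EuclideanSpace.single i (1 : ℝ))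
    rw [abs_mul, abs_mul, abs_mul, abs_of_nonneg (by positivity :
      0 ≤ |v (WithLp.toLp 2 y)| ^ (c - 2)), abs_of_pos (by linarith : 0 < c), mul_assoc c, ← hpow,
      mul_assoc]
    gcongr

theorem exists_lpP_le_gradSq_rpow {d : ℕ} (hd : 3 ≤ d) :
    ∃ S : ℝ, 0 ≤ S ∧ ∀ v : Rd d → ℝ, Differentiable ℝ v →
      Integrable (fun x => ‖gradient v x‖ ^ 2) → Integrable (fun x => |v x| ^ pstar d) →
      lpP d v ≤ S * gradSq d v ^ (pstar d / 2) := by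
  obtain ⟨n, rfl⟩ : ∃ n, d = n + 1 := ⟨d - 1, by omega⟩
  have hn : (2 : ℝ) ≤ n := by exact_mod_cast (by omega : 2 ≤ n)
  have hn1 : (n : ℝ) - 1 ≠ 0 := by linarith
  have hn0 : (0 : ℝ) < n - 1 := by linarith
  have hps : pstar (n + 1) = 2 * (n + 1) / (n - 1) := by
    rw [pstar]; push_cast; congr 1; ring
  have hp0 : 0 < pstar (n + 1) := by rw [hps]; positivity
  have hc : (1 : ℝ) < 2 * n / (n - 1) := by rw [lt_div_iff₀ hn0]; linarith
  have hq : Real.HolderConjugate ((n + 1 : ℕ) : ℝ) ((n + 1) / n) := by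
    rw [Real.holderConjugate_iff]
    push_cast
    refine ⟨by linarith, ?_⟩
    field_simp
    ring
  refine ⟨(2 * n / (n - 1)) ^ pstar (n + 1), by positivity, fun v hv hgrad hvp => ?_⟩
  refine le_rpow_mul_of_le_rpow (q := (n + 1) / n) (integral_nonneg fun x => by positivity)
    (integral_nonneg fun x => by positivity) (by positivity) hp0 (by positivity) ?_
    (integral_abs_rpow_le_mul_gradient_rpow hq hc ?_ ?_ hv hgrad hvp)
  · rw [hps]; field_simp; ring
  · rw [hps]; field_simp
  · rw [hps]; field_simp; ring

theorem W_pos {d : ℕ} (hd : 3 ≤ d) (x : Rd d) : 0 < W d x := by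
  have : (3 : ℝ) ≤ d := by exact_mod_cast hd
  have : (0 : ℝ) < d - 2 := by linarith
  unfold W
  positivity

theorem integrable_W_rpow_pstar {d : ℕ} (hd : 3 ≤ d) :
    Integrable fun x : Rd d => W d x ^ pstar d := by
  have hd' : (3 : ℝ) ≤ d := by exact_mod_cast hd
  have hd2 : (0 : ℝ) < d - 2 := by linarith
  have hc : (0 : ℝ) < d * (d - 2) := by positivity
  have hint := integrable_rpow_neg_one_add_norm_sq (E := Rd d) (μ := volume) (r := 2 * d)
    (by simp; linarith)
  refine (hint.comp_smul (R := (√((d : ℝ) * (d - 2)))⁻¹) (by positivity)).congr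
    (Filter.Eventually.of_forall fun x => ?_)
  have hbase : 0 ≤ 1 + ‖x‖ ^ 2 / ((d : ℝ) * (d - 2)) := by positivity
  simp only [W, pstar]
  rw [← rpow_mul hbase, norm_smul, mul_pow, norm_inv, inv_pow, norm_eq_abs, sq_abs,
    sq_sqrt hc.le, inv_mul_eq_div]
  congr 1
  field_simp
  ring

theorem abs_Cfun_le {d : ℕ} {K S s : ℝ} (hK : 0 ≤ K) (hs : 0 < s) (hs1 : s ≤ 1)
    (hd : 3 ≤ d)
    (hT : ∀ a b s : ℝ, 0 < a → 0 < s → s ≤ 1 →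
      |(|b + a| ^ pstar d - a ^ pstar d) / pstar d - a ^ (pstar d - 1) * b -
        (pstar d - 1) / 2 * a ^ (pstar d - 2) * b ^ 2| ≤
        K * s ^ 3 * (s ^ (-pstar d) * |b| ^ pstar d + a ^ pstar d))
    {v : Rd d → ℝ} (hvp : Integrable fun x => |v x| ^ pstar d)
    (hA : lpP d v ≤ S * s ^ pstar d) :
    |Cfun d v| ≤ K * (S + ∫ x, W d x ^ pstar d) * s ^ 3 := by
  have hW := integrable_W_rpow_pstar hd
  have hbound : Integrable fun x =>
      K * s ^ 3 * (s ^ (-pstar d) * |v x| ^ pstar d + W d x ^ pstar d) :=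
    ((hvp.const_mul _).add hW).const_mul _
  have hle : |Cfun d v| ≤
      ∫ x, K * s ^ 3 * (s ^ (-pstar d) * |v x| ^ pstar d + W d x ^ pstar d) := by
    rw [Cfun, ← Real.norm_eq_abs]
    exact norm_integral_le_of_norm_le hbound (Filter.Eventually.of_forall fun x => hT _ _ s (W_pos hd x) hs hs1)
  rw [integral_const_mul, integral_add (hvp.const_mul _) hW, integral_const_mul] at hle
  have hsA : s ^ (-pstar d) * ∫ x, |v x| ^ pstar d ≤ S := by
    rw [rpow_neg hs.le, inv_mul_le_iff₀ (by positivity)]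
    exact hA.trans_eq (mul_comm _ _)
  refine hle.trans ?_
  rw [mul_right_comm]
  gcongr

theorem Cfun_eq_zero_of_lpP_eq_zero {d : ℕ} (hd : 3 ≤ d) {v : Rd d → ℝ}
    (hvp : Integrable fun x => |v x| ^ pstar d) (h : lpP d v = 0) : Cfun d v = 0 := by
  have hae := (integral_eq_zero_iff_of_nonneg (fun x => by positivity) hvp).1 h
  refine integral_eq_zero_of_ae ?_
  filter_upwards [hae] with x hx
  have hx0 : v x = 0 := by
    by_contra hne
    exact (rpow_pos_of_pos (abs_pos.2 hne) (pstar d)).ne' hx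
  simp [hx0, abs_of_pos (W_pos hd x)]

theorem stmt_18 (d : ℕ) (hd3 : 3 ≤ d) (hd6 : d ≤ 6) :
    ∃ C₀ : ℝ, ∀ v : Rd d → ℝ,
      Differentiable ℝ v →
      Integrable (fun x => ‖gradient v x‖^2) →
      Integrable (fun x => |v x| ^ pstar d) →
      gradSq d v ≤ 1 →
      |Cfun d v| ≤ C₀ * (gradSq d v) ^ ((3:ℝ)/2) := by
  have hd3' : (3 : ℝ) ≤ d := by exact_mod_cast hd3
  have hd6' : (d : ℝ) ≤ 6 := by exact_mod_cast hd6
  have hp : 3 ≤ pstar d := by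
    rw [pstar, le_div_iff₀ (by linarith)]
    linarith
  obtain ⟨K, hK, hT⟩ := exists_abs_taylor_rpow_le hp
  obtain ⟨S, hS, hsob⟩ := exists_lpP_le_gradSq_rpow hd3
  refine ⟨K * (S + ∫ x, W d x ^ pstar d), fun v hv hgrad hvp hle => ?_⟩
  have hA := hsob v hv hgrad hvp
  have hG : 0 ≤ gradSq d v := integral_nonneg fun x => by positivity
  rcases hG.eq_or_lt with hG0 | hGpos
  · rw [← hG0, zero_rpow (by linarith), mul_zero] at hA
    rw [Cfun_eq_zero_of_lpP_eq_zero hd3 hvp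
      (hA.antisymm (integral_nonneg fun x => by positivity)), ← hG0, zero_rpow (by norm_num)]
    simp
  · have hpow (r : ℝ) : (gradSq d v ^ (1 / 2 : ℝ)) ^ r = gradSq d v ^ (r / 2) := by
      rw [← rpow_mul hG]
      congr 1
      ring
    have hC := abs_Cfun_le (s := gradSq d v ^ (1 / 2 : ℝ)) hK (by positivity)
      (rpow_le_one hG hle (by norm_num)) hd3 hT hvp (by rwa [hpow])
    rw [← rpow_natCast, hpow] at hC
    exact_mod_cast hC
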